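/- Let ν and μ be probability measures on (Ω,F). Define φ₊(x) := φ(x) for x ≥ 0 and φ₊(x) := +∞ for x < 0, with convex conjugate φ₊*(y) = sup_{x≥0} (x·y − φ(x)). Then D_φ(μ‖ν) = sup over all bounded measurable g : Ω → ℝ of the quantity [ ∫ g dμ − inf{ ∫ φ₊*(g + λ) dν − λ : λ ∈ ℝ with λ + sup_{ω∈Ω} g(ω) ≤ φ'(∞) } ], where the inner infimum over an empty constraint set is +∞. (Tight variational representation of the φ-divergence restricted to probability measures, generalizing the Donsker–Varadhan formula; instance of the paper's Corollary 4.x for the decomposable pair of all finite signed measures and all bounded measurable functions.) -/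

import Mathlib

open MeasureTheory Filter Set
open scoped ENNReal NNReal Topology

/-- Map an extended real to `ℝ≥0∞`, sending `⊤` to `⊤` and negative values to `0`. -/
noncomputable def erealToENNReal (x : EReal) : ℝ≥0∞ :=
  if x = ⊤ then ⊤ else ENNReal.ofReal x.toReal

/-- The extended integral of an `EReal`-valued function: the (Lebesgue) integral of the
positive part minus the integral of the negative part. -/
noncomputable def eIntegral {Ω : Type*} [MeasurableSpace Ω] (ν : Measure Ω)
    (f : Ω → EReal) : EReal :=
  ((∫⁻ ω, erealToENNReal (f ω) ∂ν : ℝ≥0∞) : EReal) -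
    ((∫⁻ ω, erealToENNReal (-f ω) ∂ν : ℝ≥0∞) : EReal)

/-- The φ-divergence `D_φ(μ‖ν) = ∫ φ(dμ_c/dν) dν + φ'(∞)·μ_s(Ω)` where `μ = μ_c + μ_s`
is the Lebesgue decomposition of `μ` with respect to `ν` and `dphi = φ'(∞)`. -/
noncomputable def divE {Ω : Type*} [MeasurableSpace Ω] (φ : ℝ → EReal) (dphi : EReal)
    (μ ν : Measure Ω) : EReal :=
  eIntegral ν (fun ω => φ ((μ.rnDeriv ν ω).toReal)) +
    dphi * ((μ.singularPart ν Set.univ : ℝ≥0∞) : EReal)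

/-- The convex conjugate of `φ₊` (the restriction of `φ` to the nonnegative reals,
`+∞` elsewhere): `φ₊*(y) = sup_{x ≥ 0} (x·y − φ(x))`. -/
noncomputable def phiPosStarE (φ : ℝ → EReal) (y : ℝ) : EReal :=
  ⨆ (x : ℝ) (_ : 0 ≤ x), ((x * y : ℝ) : EReal) - φ x


/-- `p t - b` is an affine minorant of `φ` on `[0,∞)`. -/
def IsMinor (φ : ℝ → EReal) (p b : ℝ) : Prop := ∀ t : ℝ, 0 ≤ t → ((p * t - b : ℝ) : EReal) ≤ φ t

lemma sep_aux (φ : ℝ → EReal)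
    (hconv : ∀ x y a b : ℝ, 0 ≤ a → 0 ≤ b → a + b = 1 →
      φ (a * x + b * y) ≤ (a : EReal) * φ x + (b : EReal) * φ y)
    (hlsc : LowerSemicontinuous φ)
    (hone : φ 1 = 0) (x c : ℝ) (h : (c : EReal) < φ x) :
    ∃ α β u : ℝ, 0 ≤ β ∧ α * x + β * c < u ∧ ∀ t s : ℝ, φ t ≤ s → u < α * t + β * s := by
  have hcl : IsClosed {p : ℝ × ℝ | φ p.1 ≤ ((p.2 : ℝ) : EReal)} :=
    hlsc.isClosed_epigraph.preimage
      (f := fun p : ℝ × ℝ => (p.1, ((p.2 : ℝ) : EReal)))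
      (continuous_fst.prodMk (continuous_coe_real_ereal.comp continuous_snd))
  have hcv : Convex ℝ {p : ℝ × ℝ | φ p.1 ≤ ((p.2 : ℝ) : EReal)} := by
    rintro ⟨t, s⟩ hp ⟨t', s'⟩ hp' a b ha hb hab
    simp only [mem_ofPred_eq, Prod.smul_mk, smul_eq_mul, Prod.mk_add_mk] at *
    refine (hconv t t' a b ha hb hab).trans ?_
    push_cast
    exact add_le_add (mul_le_mul_of_nonneg_left hp (by exact_mod_cast ha))
      (mul_le_mul_of_nonneg_left hp' (by exact_mod_cast hb))
  obtain ⟨f, u, h1, h2⟩ := geometric_hahn_banach_point_closed (x := (x, c)) hcv hcl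
    (by simpa using h)
  have hf : ∀ t s : ℝ, f (t, s) = f (1, 0) * t + f (0, 1) * s := by
    intro t s
    have : ((t, s) : ℝ × ℝ) = t • (1, 0) + s • (0, 1) := by ext <;> simp
    rw [this, map_add, map_smul, map_smul]; simp [mul_comm]
  have h3 : ∀ t s : ℝ, φ t ≤ s → u < f (1, 0) * t + f (0, 1) * s := by
    intro t s hts
    rw [← hf]; exact h2 (t, s) hts
  refine ⟨f (1, 0), f (0, 1), u, ?_, by rw [← hf]; exact h1, h3⟩
  by_contra! hneg
  obtain ⟨N, hN⟩ := exists_nat_gt ((f (1, 0) - u) / (- f (0, 1)))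
  rw [div_lt_iff₀ (by linarith)] at hN
  have := h3 1 N (by rw [hone]; exact_mod_cast N.cast_nonneg)
  nlinarith

lemma exists_minor (φ : ℝ → EReal)
    (hbot : ∀ x : ℝ, φ x ≠ ⊥)
    (hconv : ∀ x y a b : ℝ, 0 ≤ a → 0 ≤ b → a + b = 1 →
      φ (a * x + b * y) ≤ (a : EReal) * φ x + (b : EReal) * φ y)
    (hlsc : LowerSemicontinuous φ)
    (hone : φ 1 = 0) (x c : ℝ) (h : (c : EReal) < φ x) :
    ∃ p b : ℝ, IsMinor φ p b ∧ c < p * x - b := by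
  have key : ∀ (α β u x c : ℝ), 0 < β → α * x + β * c < u → 
      (∀ t s : ℝ, φ t ≤ s → u < α * t + β * s) → 
      ∃ p b : ℝ, IsMinor φ p b ∧ c < p * x - b := by
    intro α β u x c hβ h1 h2
    refine ⟨-α / β, -u / β, ?_, ?_⟩
    · intro t _
      cases ht : φ t with
      | bot => exact absurd ht (hbot t)
      | top => exact le_top
      | coe s =>
        have := h2 t s ht.le
        norm_cast
        have e : -α / β * t - -u / β = (u - α * t) / β := by field_simp; ring
        rw [e, div_le_iff₀ hβ]; linarith
    · have e : -α / β * x - -u / β = (u - α * x) / β := by field_simp; ring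
      rw [e, lt_div_iff₀ hβ]; linarith
  obtain ⟨α, β, u, hβ, h1, h2⟩ := sep_aux φ hconv hlsc hone x c h
  rcases hβ.lt_or_eq with hβ | hβ
  · exact key α β u x c hβ h1 h2
  · obtain ⟨α', β', u', hβ', h1', h2'⟩ := sep_aux φ hconv hlsc hone 1 (-1)
      (by rw [hone]; exact_mod_cast (by norm_num : (-1:ℝ) < 0))
    have hβ'' : 0 < β' := by
      have := h2' 1 0 (by rw [hone]; rfl)
      nlinarith
    obtain ⟨N, hN⟩ := exists_nat_gt ((α' * x + β' * c - u') / (u - α * x))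
    subst hβ
    have hpos : 0 < u - α * x := by linarith
    rw [div_lt_iff₀ hpos] at hN
    refine key (α' + N * α) β' (u' + N * u) x c hβ'' (by nlinarith) ?_
    intro t s hts
    have := h2 t s hts
    have := h2' t s hts
    have : (N:ℝ) * u ≤ N * (α * t) := mul_le_mul_of_nonneg_left (by linarith) N.cast_nonneg
    linarith

lemma IsMinor.le_dpos {φ : ℝ → EReal} {dpos : EReal} {p b : ℝ}
    (hdpos : Tendsto (fun x : ℝ => φ x * ((x⁻¹ : ℝ) : EReal)) atTop (𝓝 dpos))
    (h : IsMinor φ p b) : (p : EReal) ≤ dpos := by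
  have h1 : Tendsto (fun x : ℝ => ((p - b * x⁻¹ : ℝ) : EReal)) atTop (𝓝 (p : EReal)) := by
    refine (continuous_coe_real_ereal.tendsto _).comp ?_
    simpa using (tendsto_const_nhds (x := p)).sub (tendsto_inv_atTop_zero.const_mul b)
  refine le_of_tendsto_of_tendsto h1 hdpos ?_
  filter_upwards [eventually_gt_atTop 0] with x hx
  have := mul_le_mul_of_nonneg_right (h x hx.le)
    (show (0 : EReal) ≤ ((x⁻¹ : ℝ) : EReal) by exact_mod_cast (inv_pos.2 hx).le)
  refine le_trans (le_of_eq ?_) this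
  norm_cast
  field_simp

lemma exists_minor_slope {φ : ℝ → EReal} {dpos : EReal} {p0 b0 : ℝ}
    (hdpos : Tendsto (fun x : ℝ => φ x * ((x⁻¹ : ℝ) : EReal)) atTop (𝓝 dpos))
    (h0 : IsMinor φ p0 b0) (c : EReal) (hc : c < dpos) : 
    ∃ q b : ℝ, IsMinor φ q b ∧ c < q := by
  obtain ⟨q, hq1, hq2⟩ := EReal.lt_iff_exists_real_btwn.1 hc
  obtain ⟨T, hT⟩ := eventually_atTop.1 ((hdpos.eventually (lt_mem_nhds hq2)).and
    (eventually_gt_atTop 0))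
  have hT0 : 0 < T := (hT T le_rfl).2
  refine ⟨q, |q| * T + |p0| * T + |b0|, ?_, hq1⟩
  intro t ht
  rcases le_total T t with h | h
  · obtain ⟨h1, h2⟩ := hT t h
    have h3 := mul_le_mul_of_nonneg_right h1.le
      (show (0 : EReal) ≤ ((t : ℝ) : EReal) by exact_mod_cast ht)
    rw [mul_assoc, ← EReal.coe_mul t⁻¹, inv_mul_cancel₀ h2.ne', EReal.coe_one, mul_one] at h3
    refine le_trans ?_ h3
    norm_cast
    have : 0 ≤ |q| * T + |p0| * T + |b0| := by positivity
    linarith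
  · refine le_trans ?_ (h0 t ht)
    norm_cast
    have a1 : q * t ≤ |q| * T := by
      calc q * t ≤ |q| * t := mul_le_mul_of_nonneg_right (le_abs_self q) ht
        _ ≤ _ := by gcongr
    have a2 : -(p0 * t) ≤ |p0| * T := by
      calc -(p0 * t) = (-p0) * t := by ring
        _ ≤ |p0| * t := mul_le_mul_of_nonneg_right (neg_le_abs p0) ht
        _ ≤ _ := by gcongr
    have a3 := le_abs_self b0
    linarith

lemma IsMinor.star_le {φ : ℝ → EReal} {p b : ℝ} (hbot : ∀ x : ℝ, φ x ≠ ⊥)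
    (h : IsMinor φ p b) : phiPosStarE φ p ≤ b := by
  refine iSup₂_le fun t ht => ?_
  have := h t ht
  cases hs : φ t with
  | bot => exact absurd hs (hbot t)
  | top => simp
  | coe s =>
    rw [hs] at this
    norm_cast at *
    linarith [mul_comm p t]

/-- Countable family of affine minorants with pointwise supremum `φ`. -/
lemma exists_seq_minor (φ : ℝ → EReal)
    (hbot : ∀ x : ℝ, φ x ≠ ⊥)
    (hconv : ∀ x y a b : ℝ, 0 ≤ a → 0 ≤ b → a + b = 1 →
      φ (a * x + b * y) ≤ (a : EReal) * φ x + (b : EReal) * φ y)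
    (hlsc : LowerSemicontinuous φ)
    (hone : φ 1 = 0) :
    ∃ q b : ℕ → ℝ, (∀ n, IsMinor φ (q n) (b n)) ∧
      ∀ x c : ℝ, 0 ≤ x → (c : EReal) < φ x → ∃ n, c < q n * x - b n := by
  have main : ∀ x c : ℝ, 0 ≤ x → (c : EReal) < φ x → 
      ∃ r : ℚ × ℚ, IsMinor φ r.1 r.2 ∧ c < r.1 * x - r.2 := by
    intro x c hx h
    obtain ⟨p, b, h1, h2⟩ := exists_minor φ hbot hconv hlsc hone x c h
    set δ := p * x - b - c with hδ
    have hδ0 : 0 < δ := by linarith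
    obtain ⟨q, hq1, hq2⟩ := exists_rat_btwn (show p - δ / (2 * (x + 1)) < p by
      have : 0 < δ / (2 * (x + 1)) := by positivity
      linarith)
    obtain ⟨b', hb1, hb2⟩ := exists_rat_btwn (show b < b + δ / 2 by linarith)
    refine ⟨(q, b'), ?_, ?_⟩
    · intro t ht
      refine le_trans ?_ (h1 t ht)
      have := mul_le_mul_of_nonneg_right hq2.le ht
      simp only [EReal.coe_le_coe_iff]
      linarith
    · simp only
      have e : δ / (2 * (x + 1)) * x ≤ δ / 2 := by
        rw [div_mul_eq_mul_div, div_le_div_iff₀ (by positivity) (by norm_num)]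
        nlinarith
      have := mul_le_mul_of_nonneg_right hq1.le hx
      nlinarith
  obtain ⟨r0, hr0, -⟩ := main 1 (-1) zero_le_one
    (by rw [hone]; exact_mod_cast (by norm_num : (-1:ℝ) < 0))
  let V : Set (ℚ × ℚ) := {r | IsMinor φ r.1 r.2}
  obtain ⟨e, he⟩ := (Set.to_countable V).exists_eq_range ⟨r0, hr0⟩
  refine ⟨fun n => (e n).1, fun n => (e n).2, fun n => ?_, fun x c hx h => ?_⟩
  · have : e n ∈ V := by rw [he]; exact mem_range_self n
    exact this
  · obtain ⟨r, hr1, hr2⟩ := main x c hx h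
    have : r ∈ V := hr1
    rw [he] at this
    obtain ⟨n, rfl⟩ := this
    exact ⟨n, hr2⟩

/-- Measurable choice of minorants. -/
lemma exists_sel (φ : ℝ → EReal)
    (hbot : ∀ x : ℝ, φ x ≠ ⊥)
    (hconv : ∀ x y a b : ℝ, 0 ≤ a → 0 ≤ b → a + b = 1 →
      φ (a * x + b * y) ≤ (a : EReal) * φ x + (b : EReal) * φ y)
    (hlsc : LowerSemicontinuous φ)
    (hone : φ 1 = 0) :
    ∃ Q B : ℕ → ℝ → ℝ, (∀ n x, IsMinor φ (Q n x) (B n x)) ∧ (∀ n, Measurable (Q n)) ∧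
      (∀ n, Measurable (B n)) ∧ (∀ n, ∃ C, ∀ x, |Q n x| ≤ C) ∧ (∀ n, ∃ C, ∀ x, |B n x| ≤ C) ∧
      (∀ x, Monotone fun n => Q n x * x - B n x) ∧ 
      ∀ x, 0 ≤ x → Tendsto (fun n => ((Q n x * x - B n x : ℝ) : EReal)) atTop (𝓝 (φ x)) := by
  obtain ⟨q, b, h1, h2⟩ := exists_seq_minor φ hbot hconv hlsc hone
  let G : ℕ → ℝ → ℝ × ℝ := fun n => Nat.rec (fun _ => (q 0, b 0))
    (fun n g x => if (g x).1 * x - (g x).2 < q (n+1) * x - b (n+1) then (q (n+1), b (n+1))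
      else g x) n
  have G0 : ∀ x, G 0 x = (q 0, b 0) := fun x => rfl
  have GS : ∀ n x, G (n+1) x = if (G n x).1 * x - (G n x).2 < q (n+1) * x - b (n+1) then
    (q (n+1), b (n+1)) else G n x := fun n x => rfl
  have hmeas : ∀ n, Measurable (G n) := by
    intro n
    induction n with
    | zero => exact measurable_const
    | succ n ih =>
      have : G (n+1) = fun x => if (G n x).1 * x - (G n x).2 < q (n+1) * x - b (n+1) then
        (q (n+1), b (n+1)) else G n x := funext (GS n)
      rw [this]
      exact Measurable.ite (measurableSet_lt (by fun_prop) (by fun_prop)) measurable_const ih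
  have hmono : ∀ x, Monotone fun n => (G n x).1 * x - (G n x).2 := by
    intro x
    refine monotone_nat_of_le_succ fun n => ?_
    simp only [GS]
    split_ifs with h
    · exact h.le
    · exact le_rfl
  have hge : ∀ n x, q n * x - b n ≤ (G n x).1 * x - (G n x).2 := by
    intro n x
    cases n with
    | zero => simp [G0]
    | succ n =>
      simp only [GS]
      split_ifs with h
      · exact le_rfl
      · exact not_lt.1 h
  have hmin : ∀ n x, IsMinor φ (G n x).1 (G n x).2 := by
    intro n x
    induction n with
    | zero => exact h1 0
    | succ n ih =>
      simp only [GS]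
      split_ifs with h
      · exact h1 _
      · exact ih
  have hb1 : ∀ n, ∃ C, ∀ x, |(G n x).1| ≤ C := by
    intro n
    induction n with
    | zero => exact ⟨|q 0|, fun x => le_rfl⟩
    | succ n ih =>
      obtain ⟨C, hC⟩ := ih
      refine ⟨max C |q (n+1)|, fun x => ?_⟩
      simp only [GS]
      split_ifs with h
      · exact le_max_right _ _
      · exact (hC x).trans (le_max_left _ _)
  have hb2 : ∀ n, ∃ C, ∀ x, |(G n x).2| ≤ C := by
    intro n
    induction n with
    | zero => exact ⟨|b 0|, fun x => le_rfl⟩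
    | succ n ih =>
      obtain ⟨C, hC⟩ := ih
      refine ⟨max C |b (n+1)|, fun x => ?_⟩
      simp only [GS]
      split_ifs with h
      · exact le_max_right _ _
      · exact (hC x).trans (le_max_left _ _)
  refine ⟨fun n x => (G n x).1, fun n x => (G n x).2, hmin, fun n => (hmeas n).fst,
    fun n => (hmeas n).snd, hb1, hb2, hmono, fun x hx => ?_⟩
  refine tendsto_order.2 ⟨fun c hc => ?_, fun c hc => ?_⟩
  · obtain ⟨c', hc1, hc2⟩ := EReal.lt_iff_exists_real_btwn.1 hc
    obtain ⟨n, hn⟩ := h2 x c' hx hc2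
    filter_upwards [eventually_ge_atTop n] with m hm
    refine hc1.trans ?_
    have := hmono x hm
    have := hge n x
    simp only at *
    exact_mod_cast (by linarith)
  · exact Eventually.of_forall fun n => (hmin n x x hx).trans_lt hc

lemma erealToENNReal_eq (x : EReal) : erealToENNReal x = x.toENNReal := rfl

lemma eIntegral_mono_ae {Ω : Type*} [MeasurableSpace Ω] {ν : Measure Ω} {f g : Ω → EReal}
    (h : ∀ᵐ ω ∂ν, f ω ≤ g ω) : eIntegral ν f ≤ eIntegral ν g := by
  unfold eIntegral
  refine EReal.sub_le_sub ?_ ?_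
  · refine EReal.coe_ennreal_le_coe_ennreal_iff.2 (lintegral_mono_ae ?_)
    filter_upwards [h] with ω hω
    exact EReal.toENNReal_le_toENNReal hω
  · refine EReal.coe_ennreal_le_coe_ennreal_iff.2 (lintegral_mono_ae ?_)
    filter_upwards [h] with ω hω
    exact EReal.toENNReal_le_toENNReal (EReal.neg_le_neg_iff.2 hω)

lemma lintegral_ofReal_ne_top {Ω : Type*} [MeasurableSpace Ω] {ν : Measure Ω} {f : Ω → ℝ}
    (hf : Integrable f ν) : ∫⁻ ω, ENNReal.ofReal (f ω) ∂ν ≠ ⊤ := by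
  have := hf.lintegral_lt_top
  exact this.ne

lemma eIntegral_coe {Ω : Type*} [MeasurableSpace Ω] {ν : Measure Ω} {f : Ω → ℝ}
    (hf : Integrable f ν) : eIntegral ν (fun ω => ((f ω : ℝ) : EReal)) = ((∫ ω, f ω ∂ν : ℝ) : EReal) := by
  rw [integral_eq_lintegral_pos_part_sub_lintegral_neg_part hf]
  have h1 := lintegral_ofReal_ne_top hf
  have h2 : ∫⁻ ω, ENNReal.ofReal (-f ω) ∂ν ≠ ⊤ := lintegral_ofReal_ne_top hf.neg
  unfold eIntegral
  simp only [erealToENNReal_eq, ← EReal.coe_neg, EReal.real_coe_toENNReal]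
  rw [EReal.coe_sub, EReal.coe_ennreal_toReal, EReal.coe_ennreal_toReal]
  all_goals assumption

lemma eIntegral_tendsto {Ω : Type*} [MeasurableSpace Ω] {ν : Measure Ω} {f : ℕ → Ω → ℝ}
    {F : Ω → EReal} (hf : ∀ n, Integrable (f n) ν)
    (hm : ∀ n, Measurable (f n)) (hmono : ∀ ω, Monotone fun n => f n ω)
    (hlim : ∀ ω, Tendsto (fun n => ((f n ω : ℝ) : EReal)) atTop (𝓝 (F ω))) :
    Tendsto (fun n => ((∫ ω, f n ω ∂ν : ℝ) : EReal)) atTop (𝓝 (eIntegral ν F)) := by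
  simp_rw [← fun n => eIntegral_coe (hf n)]
  unfold eIntegral
  simp only [erealToENNReal_eq]
  have hneg : ∀ ω, Tendsto (fun n => (-((f n ω : ℝ) : EReal))) atTop (𝓝 (-F ω)) :=
    fun ω => (continuous_neg.tendsto _).comp (hlim ω)
  have t1 : Tendsto (fun n => ∫⁻ ω, ((f n ω : ℝ) : EReal).toENNReal ∂ν) atTop
      (𝓝 (∫⁻ ω, (F ω).toENNReal ∂ν)) := by
    refine lintegral_tendsto_of_tendsto_of_monotone ?_ ?_ ?_
    · intro n
      exact (EReal.continuous_toENNReal.measurable.comp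
        (measurable_coe_real_ereal.comp (hm n))).aemeasurable
    · refine Eventually.of_forall fun ω n m hnm => EReal.toENNReal_le_toENNReal ?_
      exact_mod_cast hmono ω hnm
    · exact Eventually.of_forall fun ω => (EReal.continuous_toENNReal.tendsto _).comp (hlim ω)
  have hfin : ∫⁻ ω, (-((f 0 ω : ℝ) : EReal)).toENNReal ∂ν ≠ ⊤ := by
    simp only [← EReal.coe_neg, EReal.real_coe_toENNReal]
    exact lintegral_ofReal_ne_top (hf 0).neg
  have hb : ∀ n ω, (-((f n ω : ℝ) : EReal)).toENNReal ≤ (-((f 0 ω : ℝ) : EReal)).toENNReal := by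
    intro n ω
    refine EReal.toENNReal_le_toENNReal (EReal.neg_le_neg_iff.2 ?_)
    exact_mod_cast hmono ω (Nat.zero_le n)
  have t2 : Tendsto (fun n => ∫⁻ ω, (-((f n ω : ℝ) : EReal)).toENNReal ∂ν) atTop
      (𝓝 (∫⁻ ω, (-F ω).toENNReal ∂ν)) := by
    refine tendsto_lintegral_of_dominated_convergence
      (fun ω => (-((f 0 ω : ℝ) : EReal)).toENNReal) ?_ ?_ hfin ?_
    · intro n
      exact EReal.continuous_toENNReal.measurable.comp
        (measurable_coe_real_ereal.comp (hm n)).neg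
    · exact fun n => Eventually.of_forall (hb n)
    · exact Eventually.of_forall fun ω => (EReal.continuous_toENNReal.tendsto _).comp (hneg ω)
  have hfin2 : ∫⁻ ω, (-F ω).toENNReal ∂ν ≠ ⊤ :=
    ne_top_of_le_ne_top hfin (le_of_tendsto' t2 fun n => lintegral_mono (hb n))
  simp only [sub_eq_add_neg]
  refine Tendsto.comp (EReal.continuousAt_add (p := (_, _)) (Or.inr ?_) (Or.inl ?_))
    (Tendsto.prodMk_nhds ((continuous_coe_ennreal_ereal.tendsto _).comp t1) 
      ((continuous_neg.tendsto _).comp ((continuous_coe_ennreal_ereal.tendsto _).comp t2)))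
  · simpa using hfin2
  · simp

lemma exists_real_of_eIntegral_ne_top {Ω : Type*} [MeasurableSpace Ω] {ν : Measure Ω}
    {F : Ω → EReal} (hF : Measurable F) {h : Ω → ℝ} (hh : Integrable h ν)
    (hle : ∀ ω, ((h ω : ℝ) : EReal) ≤ F ω) (htop : eIntegral ν F ≠ ⊤) :
    ∃ k : Ω → ℝ, Integrable k ν ∧ (∀ᵐ ω ∂ν, F ω = ((k ω : ℝ) : EReal)) ∧
      eIntegral ν F = ((∫ ω, k ω ∂ν : ℝ) : EReal) := by
  have hn : ∫⁻ ω, (-F ω).toENNReal ∂ν ≠ ⊤ := by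
    refine ne_top_of_le_ne_top (lintegral_ofReal_ne_top hh.neg) (lintegral_mono fun ω => ?_)
    have := EReal.toENNReal_le_toENNReal (EReal.neg_le_neg_iff.2 (hle ω))
    simp only [← EReal.coe_neg, EReal.real_coe_toENNReal] at this
    exact this
  have hp : ∫⁻ ω, (F ω).toENNReal ∂ν ≠ ⊤ := by
    intro hp
    apply htop
    unfold eIntegral
    simp only [erealToENNReal_eq]
    rw [hp, EReal.coe_ennreal_top, EReal.top_sub]
    simpa using hn
  have hm1 : Measurable fun ω => (F ω).toENNReal := EReal.continuous_toENNReal.measurable.comp hF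
  have hm2 : Measurable fun ω => (-F ω).toENNReal :=
    EReal.continuous_toENNReal.measurable.comp hF.neg
  have hae : ∀ᵐ ω ∂ν, F ω = (((F ω).toReal : ℝ) : EReal) := by
    filter_upwards [ae_lt_top hm1 hp] with ω hω
    refine (EReal.coe_toReal ?_ ?_).symm
    · intro h; simp [h] at hω
    · intro h; have := hle ω; simp [h] at this
  have hi : Integrable (fun ω => (F ω).toReal) ν := by
    have h1 := (integrable_toReal_of_lintegral_ne_top hm1.aemeasurable hp).sub
      (integrable_toReal_of_lintegral_ne_top hm2.aemeasurable hn)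
    refine h1.congr ?_
    filter_upwards [hae] with ω hω
    generalize hx : (F ω).toReal = x at hω
    simp only [Pi.sub_apply, hω, ← EReal.coe_neg, EReal.real_coe_toENNReal]
    rw [ENNReal.toReal_ofReal', ENNReal.toReal_ofReal']
    exact max_zero_sub_max_neg_zero_eq_self x
  refine ⟨_, hi, hae, ?_⟩
  rw [← eIntegral_coe hi]
  exact le_antisymm (eIntegral_mono_ae (hae.mono fun ω h => h.le))
    (eIntegral_mono_ae (hae.mono fun ω h => h.ge))

lemma integrable_of_bdd {Ω : Type*} [MeasurableSpace Ω] (μ : Measure Ω) [IsFiniteMeasure μ]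
    {h : Ω → ℝ} (hm : Measurable h) (hb : ∃ C, ∀ ω, |h ω| ≤ C) : Integrable h μ := by
  obtain ⟨C, hC⟩ := hb
  exact Integrable.of_bound hm.aestronglyMeasurable C (Eventually.of_forall hC)

lemma integrable_mul_rn {Ω : Type*} [MeasurableSpace Ω] (μ ν : Measure Ω) [IsFiniteMeasure μ]
    {h : Ω → ℝ} (hm : Measurable h) (hb : ∃ C, ∀ ω, |h ω| ≤ C) :
    Integrable (fun ω => h ω * (μ.rnDeriv ν ω).toReal) ν := by
  obtain ⟨C, hC⟩ := hb
  exact Measure.integrable_toReal_rnDeriv.bdd_mul hm.aestronglyMeasurable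
    (Eventually.of_forall hC)

lemma integral_split {Ω : Type*} [MeasurableSpace Ω] (μ ν : Measure Ω) [IsFiniteMeasure μ]
    [IsFiniteMeasure ν] {h : Ω → ℝ} (hm : Measurable h) (hb : ∃ C, ∀ ω, |h ω| ≤ C) :
    ∫ ω, h ω ∂μ = ∫ ω, h ω * (μ.rnDeriv ν ω).toReal ∂ν + ∫ ω, h ω ∂(μ.singularPart ν) := by
  conv_lhs => rw [μ.haveLebesgueDecomposition_add ν]
  rw [integral_add_measure (integrable_of_bdd _ hm hb) (integrable_of_bdd _ hm hb),
    integral_withDensity_eq_integral_toReal_smul (μ.measurable_rnDeriv ν) (μ.rnDeriv_lt_top ν),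
    add_comm]
  simp [mul_comm]

lemma measurable_star (φ : ℝ → EReal) (hbot : ∀ x : ℝ, φ x ≠ ⊥) :
    Measurable (phiPosStarE φ) := by
  apply LowerSemicontinuous.measurable
  unfold phiPosStarE
  refine lowerSemicontinuous_iSup fun x => lowerSemicontinuous_iSup fun hx => ?_
  apply Continuous.lowerSemicontinuous
  cases hs : φ x with
  | bot => exact absurd hs (hbot x)
  | top => simpa using continuous_const
  | coe s =>
    simp only [← EReal.coe_sub]
    exact continuous_coe_real_ereal.comp (by fun_prop)

lemma value_le_div {Ω : Type*} [MeasurableSpace Ω]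
    (φ : ℝ → EReal)
    (hbot : ∀ x : ℝ, φ x ≠ ⊥)
    (hone : φ 1 = 0)
    (dpos : EReal)
    (μ ν : Measure Ω) [IsProbabilityMeasure μ] [IsProbabilityMeasure ν]
    (h : Ω → ℝ) (hm : Measurable h) (hb : ∃ C : ℝ, ∀ ω, |h ω| ≤ C)
    (hd : ∀ ω, ((h ω : ℝ) : EReal) ≤ dpos) :
    ((∫ ω, h ω ∂μ : ℝ) : EReal) - eIntegral ν (fun ω => phiPosStarE φ (h ω)) ≤ divE φ dpos μ ν := by
  by_cases htop : eIntegral ν (fun ω => phiPosStarE φ (h ω)) = ⊤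
  · rw [htop]; simp
  obtain ⟨k, hk, hkae, hkint⟩ := exists_real_of_eIntegral_ne_top
    ((measurable_star φ hbot).comp hm) (integrable_of_bdd ν hm hb)
    (fun ω => by
      refine le_trans (le_of_eq ?_) (le_iSup₂ (1 : ℝ) zero_le_one)
      simp [hone]) htop
  rw [show eIntegral ν (fun ω => phiPosStarE φ (h ω)) = _ from hkint, integral_split μ ν hm hb]
  have hI := integrable_mul_rn μ ν hm hb
  have e : ((∫ ω, h ω * (μ.rnDeriv ν ω).toReal ∂ν + ∫ ω, h ω ∂(μ.singularPart ν) : ℝ) : EReal)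
      - ((∫ ω, k ω ∂ν : ℝ) : EReal) = ((∫ ω, (h ω * (μ.rnDeriv ν ω).toReal - k ω) ∂ν : ℝ) : EReal)
        + ((∫ ω, h ω ∂(μ.singularPart ν) : ℝ) : EReal) := by
    rw [integral_sub hI hk]
    norm_cast
    ring
  rw [e]
  unfold divE
  refine add_le_add ?_ ?_
  · rw [← eIntegral_coe (f := fun ω => h ω * (μ.rnDeriv ν ω).toReal - k ω) (hI.sub hk)]
    refine eIntegral_mono_ae ?_
    filter_upwards [hkae] with ω hω
    have h1 : (((μ.rnDeriv ν ω).toReal * h ω : ℝ) : EReal) - φ ((μ.rnDeriv ν ω).toReal)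
        ≤ ((k ω : ℝ) : EReal) := by
      rw [← hω]
      exact le_iSup₂ (f := fun (x : ℝ) (_ : 0 ≤ x) => ((x * h ω : ℝ) : EReal) - φ x)
        (μ.rnDeriv ν ω).toReal ENNReal.toReal_nonneg
    cases hs : φ ((μ.rnDeriv ν ω).toReal) with
    | bot => exact absurd hs (hbot _)
    | top => exact le_top
    | coe s =>
      rw [hs] at h1

      norm_cast at *
      linarith [mul_comm (h ω) (μ.rnDeriv ν ω).toReal]
  · obtain ⟨ω0⟩ : Nonempty Ω := μ.nonempty_of_neZero
    have hms : μ.singularPart ν univ ≠ ⊤ := measure_ne_top _ _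
    cases dpos with
    | bot => exact absurd (hd ω0) (by simp)
    | top =>
      by_cases h0 : μ.singularPart ν univ = 0
      · have : μ.singularPart ν = 0 := Measure.measure_univ_eq_zero.1 h0
        simp [this]
      · rw [EReal.top_mul_of_pos]
        · exact le_top
        · exact EReal.coe_ennreal_pos.2 (pos_iff_ne_zero.2 h0)
    | coe d =>
      rw [← EReal.coe_ennreal_toReal hms, ← EReal.coe_mul, EReal.coe_le_coe_iff]
      calc ∫ ω, h ω ∂(μ.singularPart ν) ≤ ∫ ω, d ∂(μ.singularPart ν) := 
            integral_mono (integrable_of_bdd _ hm hb) (integrable_const _)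
              (fun ω => by exact_mod_cast hd ω)
        _ = _ := by simp [Measure.real, mul_comm]

lemma div_le_sup {Ω : Type*} [MeasurableSpace Ω]
    (φ : ℝ → EReal)
    (hbot : ∀ x : ℝ, φ x ≠ ⊥)
    (hconv : ∀ x y a b : ℝ, 0 ≤ a → 0 ≤ b → a + b = 1 →
      φ (a * x + b * y) ≤ (a : EReal) * φ x + (b : EReal) * φ y)
    (hlsc : LowerSemicontinuous φ)
    (hone : φ 1 = 0)
    (dpos : EReal)
    (hdpos : Tendsto (fun x : ℝ => φ x * ((x⁻¹ : ℝ) : EReal)) atTop (𝓝 dpos))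
    (μ ν : Measure Ω) [IsProbabilityMeasure μ] [IsProbabilityMeasure ν] (R : EReal)
    (hR : ∀ h : Ω → ℝ, Measurable h → (∃ C : ℝ, ∀ ω, |h ω| ≤ C) →
      (∀ ω, ((h ω : ℝ) : EReal) ≤ dpos) →
      ((∫ ω, h ω ∂μ : ℝ) : EReal) - eIntegral ν (fun ω => phiPosStarE φ (h ω)) ≤ R) :
    divE φ dpos μ ν ≤ R := by
  obtain ⟨Q, B, hmin, hQm, hBm, hQb, hBb, hmono, hlim⟩ := exists_sel φ hbot hconv hlsc hone
  set r : Ω → ℝ := fun ω => (μ.rnDeriv ν ω).toReal with hr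
  have hrm : Measurable r := (μ.measurable_rnDeriv ν).ennreal_toReal
  have hQr : ∀ n, Integrable (fun ω => Q n (r ω) * r ω) ν := fun n =>
    integrable_mul_rn μ ν ((hQm n).comp hrm) ((hQb n).imp fun C hC ω => hC _)
  have hBr : ∀ n, Integrable (fun ω => B n (r ω)) ν := fun n =>
    integrable_of_bdd ν ((hBm n).comp hrm) ((hBb n).imp fun C hC ω => hC _)
  have htend : Tendsto (fun n => ((∫ ω, (Q n (r ω) * r ω - B n (r ω)) ∂ν : ℝ) : EReal)) atTop
      (𝓝 (eIntegral ν (fun ω => φ (r ω)))) := by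
    refine eIntegral_tendsto (fun n => (hQr n).sub (hBr n)) (fun n => ?_) (fun ω => hmono (r ω))
      (fun ω => hlim (r ω) ENNReal.toReal_nonneg)
    exact (((hQm n).comp hrm).mul hrm).sub ((hBm n).comp hrm)
  set m : ℝ := (μ.singularPart ν univ).toReal with hmdef
  have hm0 : 0 ≤ m := ENNReal.toReal_nonneg
  have hms : ((m : ℝ) : EReal) = ((μ.singularPart ν univ : ℝ≥0∞) : EReal) :=
    EReal.coe_ennreal_toReal (measure_ne_top _ _)
  obtain ⟨S, hS, hS1, hS2⟩ := μ.mutuallySingular_singularPart ν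
  -- `S` is null for the singular part, its complement is `ν`-null
  have key : ∀ n q b, IsMinor φ q b →
      ((∫ ω, (Q n (r ω) * r ω - B n (r ω)) ∂ν : ℝ) : EReal) + ((q * m : ℝ) : EReal) ≤ R := by
    intro n q b hq
    classical
    let g : Ω → ℝ := S.piecewise (fun ω => Q n (r ω)) (fun _ => q)
    have hgm : Measurable g := Measurable.piecewise hS ((hQm n).comp hrm) measurable_const
    have hgb : ∃ C : ℝ, ∀ ω, |g ω| ≤ C := by
      obtain ⟨C, hC⟩ := hQb n
      refine ⟨max C |q|, fun ω => ?_⟩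
      by_cases hω : ω ∈ S
      · simp only [g, piecewise_eq_of_mem _ _ _ hω]
        exact (hC _).trans (le_max_left _ _)
      · simp only [g, piecewise_eq_of_notMem _ _ _ hω]
        exact le_max_right _ _
    have hgd : ∀ ω, ((g ω : ℝ) : EReal) ≤ dpos := by
      intro ω
      by_cases hω : ω ∈ S
      · simp only [g, piecewise_eq_of_mem _ _ _ hω]
        exact (hmin n _).le_dpos hdpos
      · simp only [g, piecewise_eq_of_notMem _ _ _ hω]
        exact hq.le_dpos hdpos
    have aeν : ∀ᵐ ω ∂ν, g ω = Q n (r ω) := by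
      have : ∀ᵐ ω ∂ν, ω ∈ S := by rw [ae_iff]; exact hS2
      filter_upwards [this] with ω hω
      simp only [g, piecewise_eq_of_mem _ _ _ hω]
    have aes : ∀ᵐ ω ∂(μ.singularPart ν), g ω = q := by
      have : ∀ᵐ ω ∂(μ.singularPart ν), ω ∉ S := by rw [ae_iff]; simpa using hS1
      filter_upwards [this] with ω hω
      simp only [g, piecewise_eq_of_notMem _ _ _ hω]
    refine le_trans ?_ (hR g hgm hgb hgd)
    have i1 : ∫ ω, g ω ∂μ = ∫ ω, Q n (r ω) * r ω ∂ν + q * m := by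
      rw [integral_split μ ν hgm hgb, integral_congr_ae aes]
      congr 1
      · refine integral_congr_ae ?_
        filter_upwards [aeν] with ω hω
        rw [hω]
      · simp [Measure.real, mul_comm, hmdef]
    have i2 : eIntegral ν (fun ω => phiPosStarE φ (g ω)) ≤ ((∫ ω, B n (r ω) ∂ν : ℝ) : EReal) := by
      rw [← eIntegral_coe (hBr n)]
      refine eIntegral_mono_ae ?_
      filter_upwards [aeν] with ω hω
      rw [hω]
      exact (hmin n _).star_le hbot
    refine le_trans (le_of_eq ?_) (EReal.sub_le_sub le_rfl i2)
    rw [i1, integral_sub (hQr n) (hBr n)]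
    norm_cast
    ring
  unfold divE
  refine EReal.add_le_of_forall_lt fun a ha b hb => ?_
  obtain ⟨n, hn⟩ := (htend.eventually (lt_mem_nhds ha)).exists
  suffices h : ∃ q c : ℝ, IsMinor φ q c ∧ b ≤ ((q * m : ℝ) : EReal) by
    obtain ⟨q, c, h1, h2⟩ := h
    exact (add_le_add hn.le h2).trans (key n q c h1)
  rw [← hms] at hb
  rcases hm0.lt_or_eq with hm | hm
  · have hb' : b * ((m⁻¹ : ℝ) : EReal) < dpos := by
      by_contra! hcon
      have := mul_le_mul_of_nonneg_right hcon
        (show (0 : EReal) ≤ ((m : ℝ) : EReal) by exact_mod_cast hm0)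
      rw [mul_assoc, ← EReal.coe_mul m⁻¹, inv_mul_cancel₀ hm.ne', EReal.coe_one, mul_one] at this
      exact absurd hb this.not_gt
    obtain ⟨q, c, h1, h2⟩ := exists_minor_slope hdpos (hmin 0 0) _ hb'
    refine ⟨q, c, h1, ?_⟩
    have := mul_le_mul_of_nonneg_right h2.le
        (show (0 : EReal) ≤ ((m : ℝ) : EReal) by exact_mod_cast hm0)
    rwa [mul_assoc, ← EReal.coe_mul m⁻¹, inv_mul_cancel₀ hm.ne', EReal.coe_one, mul_one,
      ← EReal.coe_mul] at this
  · refine ⟨_, _, hmin 0 0, ?_⟩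
    rw [← hm] at hb ⊢
    simpa using hb.le

lemma coe_sub_le_iff (a : ℝ) (x D : EReal) : (a : EReal) - x ≤ D ↔ -(D - a) ≤ x := by
  rw [sub_eq_add_neg, add_comm, ← EReal.le_sub_iff_add_le (by simp) (by simp), EReal.neg_le]

/-- **Tight variational representation of the φ-divergence for probability measures**
(generalized Donsker–Varadhan).  Let `φ` be proper convex lsc with `φ(1) = 0` and `1` in
the interior of its domain, and `φ'(∞) = lim_{x→∞} φ(x)/x`.  For probability measures
`μ, ν`:
`D_φ(μ‖ν) = sup_{g bounded measurable} [ ∫ g dμ −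
    inf { ∫ φ₊*(g+λ) dν − λ : λ ∈ ℝ, λ + sup_ω g(ω) ≤ φ'(∞) } ]`,
the inner infimum over an empty constraint set being `+∞`. -/
theorem divergence_eq_biconjugate_prob {Ω : Type*} [MeasurableSpace Ω]
    (φ : ℝ → EReal)
    (hbot : ∀ x : ℝ, φ x ≠ ⊥)
    (hconv : ∀ x y a b : ℝ, 0 ≤ a → 0 ≤ b → a + b = 1 →
      φ (a * x + b * y) ≤ (a : EReal) * φ x + (b : EReal) * φ y)
    (hlsc : LowerSemicontinuous φ)
    (hone : φ 1 = 0)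
    (hdom : (1 : ℝ) ∈ interior {x : ℝ | φ x ≠ ⊤})
    (dpos : EReal)
    (hdpos : Tendsto (fun x : ℝ => φ x * ((x⁻¹ : ℝ) : EReal)) atTop (𝓝 dpos))
    (μ ν : Measure Ω) [IsProbabilityMeasure μ] [IsProbabilityMeasure ν] :
    divE φ dpos μ ν =
      ⨆ (g : Ω → ℝ) (_ : Measurable g ∧ ∃ C : ℝ, ∀ ω, |g ω| ≤ C),
        (((∫ ω, g ω ∂μ : ℝ) : EReal) -
          ⨅ (lam : ℝ) (_ : (lam : EReal) + (⨆ ω : Ω, ((g ω : ℝ) : EReal)) ≤ dpos),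
            (eIntegral ν (fun ω => phiPosStarE φ (g ω + lam)) - (lam : EReal))) := by
  have hne : Nonempty Ω := μ.nonempty_of_neZero
  refine le_antisymm ?_ ?_
  · refine div_le_sup φ hbot hconv hlsc hone dpos hdpos μ ν _ fun h hm hb hd => ?_
    refine le_trans ?_ (le_iSup₂ h ⟨hm, hb⟩)
    refine EReal.sub_le_sub le_rfl ?_
    refine (iInf₂_le (0 : ℝ) ?_).trans ?_
    · simpa using hd
    · simp
  · refine iSup₂_le fun g hg => ?_
    rw [coe_sub_le_iff]
    refine le_iInf₂ fun lam hlam => ?_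
    rw [← coe_sub_le_iff]
    have hb : ∃ C : ℝ, ∀ ω, |g ω + lam| ≤ C := by
      obtain ⟨C, hC⟩ := hg.2
      exact ⟨C + |lam|, fun ω => (abs_add_le _ _).trans (by linarith [hC ω])⟩
    refine le_trans (le_of_eq ?_) (value_le_div φ hbot hone dpos μ ν (fun ω => g ω + lam)
      (hg.1.add_const lam) hb fun ω => ?_)
    · rw [integral_add (integrable_of_bdd μ hg.1 hg.2) (integrable_const lam)]
      cases eIntegral ν (fun ω => phiPosStarE φ (g ω + lam)) with
      | bot => simp [← EReal.coe_add]
      | top => simp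
      | coe s =>
        simp only [integral_const, probReal_univ, one_smul]
        norm_cast
        ring
    · refine le_trans ?_ hlam
      rw [EReal.coe_add, add_comm]
      exact add_le_add le_rfl (le_iSup (fun ω => ((g ω : ℝ) : EReal)) ω)
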